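/- The curvature of the Γ-linear connection ∇ satisfies, for all i, j, k: R(δ/δx^k, δ/δx^j) δ/δx^i = Σ_l R^l_{ijk} · δ/δx^l, where R^l_{ijk} := δL^l_{ij}/δx^k − δL^l_{ik}/δx^j + Σ_r (L^r_{ij} L^l_{rk} − L^r_{ik} L^l_{rj}) + Σ_r C^l_{ir} R^r_{jk}, with R^r_{jk} := δN^r_j/δx^k − δN^r_k/δx^j. -/

import Mathlib

noncomputable section
open scoped BigOperators

/-- The local model `E = ℝ × (Fin n → ℝ) × (Fin n → ℝ)` of the 1-jet space `J¹(ℝ,M)`,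
with coordinates `(t, x, y)`. -/
abbrev E (n : ℕ) : Type := ℝ × (Fin n → ℝ) × (Fin n → ℝ)

variable {n : ℕ}

/-- Partial derivative `∂f/∂t`. -/
def pT (f : E n → ℝ) (p : E n) : ℝ := fderiv ℝ f p (1, 0, 0)

/-- Partial derivative `∂f/∂x^i`. -/
def pX (f : E n → ℝ) (i : Fin n) (p : E n) : ℝ := fderiv ℝ f p (0, Pi.single i 1, 0)

/-- Partial derivative `∂f/∂y^i`. -/
def pY (f : E n → ℝ) (i : Fin n) (p : E n) : ℝ := fderiv ℝ f p (0, 0, Pi.single i 1)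

/-- The adapted temporal frame field `δ/δt = ∂/∂t - Σ_j M^j ∂/∂y^j`. -/
def delT (M : E n → Fin n → ℝ) (p : E n) : E n := (1, 0, fun j => -(M p j))

/-- The adapted spatial frame field `δ/δx^i = ∂/∂x^i - Σ_j N^j_i ∂/∂y^j`. -/
def delX (N : E n → Fin n → Fin n → ℝ) (i : Fin n) (p : E n) : E n :=
  (0, Pi.single i 1, fun j => -(N p i j))

/-- The vertical frame field `∂/∂y^i`. -/
def delY (i : Fin n) (p : E n) : E n := ((0 : ℝ), (0 : Fin n → ℝ), Pi.single i 1)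

/-- The Lie bracket `[X,Y](p) = (DY)(p)(X(p)) - (DX)(p)(Y(p))` of vector fields on `E`. -/
def lieBr (X Y : E n → E n) (p : E n) : E n := fderiv ℝ Y p (X p) - fderiv ℝ X p (Y p)

/-- `δf/δt := ∂f/∂t - Σ_k M^k ∂f/∂y^k`. -/
def dT (M : E n → Fin n → ℝ) (f : E n → ℝ) (p : E n) : ℝ :=
  pT f p - ∑ k, M p k * pY f k p

/-- `δf/δx^i := ∂f/∂x^i - Σ_k N^k_i ∂f/∂y^k`. -/
def dX (N : E n → Fin n → Fin n → ℝ) (f : E n → ℝ) (i : Fin n) (p : E n) : ℝ :=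
  pX f i p - ∑ k, N p i k * pY f k p

/-- A d-vector field `X = a·δ/δt + Σ_i b^i·δ/δx^i + Σ_i c^i·∂/∂y^i`
given by its adapted components. -/
structure DVF (n : ℕ) where
  a : E n → ℝ
  b : E n → Fin n → ℝ
  c : E n → Fin n → ℝ

/-- The actual vector field on `E` determined by the adapted components of a `DVF`. -/
def DVF.realize (M : E n → Fin n → ℝ) (N : E n → Fin n → Fin n → ℝ) (X : DVF n)
    (p : E n) : E n :=
  (X.a p, X.b p, fun j => X.c p j - X.a p * M p j - ∑ i, X.b p i * N p i j)

/-- The nine families of adapted coefficients of a Γ-linear connection `∇`: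
`Ḡ¹₁₁, G^k_{i1}, G^{(k)(1)}_{(1)(i)1}, L̄¹_{1j}, L^k_{ij}, L^{(k)(1)}_{(1)(i)j},
C̄^{1(1)}_{1(j)}, C^{k(1)}_{i(j)}, C^{(k)(1)(1)}_{(1)(i)(j)}`. -/
structure Conn (n : ℕ) where
  Gbar : E n → ℝ
  G : E n → Fin n → Fin n → ℝ
  Gv : E n → Fin n → Fin n → ℝ
  Lbar : E n → Fin n → ℝ
  L : E n → Fin n → Fin n → Fin n → ℝ
  Lv : E n → Fin n → Fin n → Fin n → ℝ
  Cbar : E n → Fin n → ℝ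
  C : E n → Fin n → Fin n → Fin n → ℝ
  Cv : E n → Fin n → Fin n → Fin n → ℝ

/-- All nine coefficient families are smooth. -/
def Conn.Smooth (K : Conn n) : Prop :=
  ContDiff ℝ (⊤ : ℕ∞) K.Gbar ∧ ContDiff ℝ (⊤ : ℕ∞) K.G ∧ ContDiff ℝ (⊤ : ℕ∞) K.Gv ∧ ContDiff ℝ (⊤ : ℕ∞) K.Lbar ∧
  ContDiff ℝ (⊤ : ℕ∞) K.L ∧ ContDiff ℝ (⊤ : ℕ∞) K.Lv ∧ ContDiff ℝ (⊤ : ℕ∞) K.Cbar ∧ ContDiff ℝ (⊤ : ℕ∞) K.C ∧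
  ContDiff ℝ (⊤ : ℕ∞) K.Cv

/-- Derivative `X(f)(p) := Df(p)(X(p))` of `f` along the realized vector field of `X`. -/
def Xder (M : E n → Fin n → ℝ) (N : E n → Fin n → Fin n → ℝ) (X : DVF n) (f : E n → ℝ)
    (p : E n) : ℝ := fderiv ℝ f p (X.realize M N p)

/-- The Γ-linear connection `∇_X W` in adapted components. -/
def nabla (M : E n → Fin n → ℝ) (N : E n → Fin n → Fin n → ℝ) (K : Conn n)
    (X W : DVF n) : DVF n where
  a := fun p => Xder M N X W.a p +
    W.a p * (X.a p * K.Gbar p + ∑ j, X.b p j * K.Lbar p j + ∑ j, X.c p j * K.Cbar p j)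
  b := fun p k => Xder M N X (fun q => W.b q k) p +
    ∑ i, W.b p i *
      (X.a p * K.G p k i + ∑ j, X.b p j * K.L p k i j + ∑ j, X.c p j * K.C p k i j)
  c := fun p k => Xder M N X (fun q => W.c q k) p +
    ∑ i, W.c p i *
      (X.a p * K.Gv p k i + ∑ j, X.b p j * K.Lv p k i j + ∑ j, X.c p j * K.Cv p k i j)

/-- The adapted frame field `δ/δt` as a `DVF`. -/
def frT : DVF n := ⟨fun _ => 1, fun _ => 0, fun _ => 0⟩

/-- The adapted frame field `δ/δx^i` as a `DVF`. -/
def frX (i : Fin n) : DVF n := ⟨fun _ => 0, fun _ => Pi.single i 1, fun _ => 0⟩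

/-- The adapted frame field `∂/∂y^i` as a `DVF`. -/
def frY (i : Fin n) : DVF n := ⟨fun _ => 0, fun _ => 0, fun _ => Pi.single i 1⟩

/-- Decomposition of an arbitrary vector field into adapted components. -/
def decomp (M : E n → Fin n → ℝ) (N : E n → Fin n → Fin n → ℝ) (V : E n → E n) : DVF n :=
  ⟨fun p => (V p).1, fun p => (V p).2.1,
   fun p j => (V p).2.2 j + (V p).1 * M p j + ∑ i, (V p).2.1 i * N p i j⟩

/-- The torsion `T(X,Y) := ∇_X Y - ∇_Y X - [X,Y]`. -/
def torsion (M : E n → Fin n → ℝ) (N : E n → Fin n → Fin n → ℝ) (K : Conn n)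
    (X Y : DVF n) (p : E n) : E n :=
  (nabla M N K X Y).realize M N p - (nabla M N K Y X).realize M N p -
    lieBr (X.realize M N) (Y.realize M N) p

/-- The curvature `R(X,Y)Z := ∇_X(∇_Y Z) - ∇_Y(∇_X Z) - ∇_{[X,Y]}Z`. -/
def curv (M : E n → Fin n → ℝ) (N : E n → Fin n → Fin n → ℝ) (K : Conn n)
    (X Y Z : DVF n) (p : E n) : E n :=
  (nabla M N K X (nabla M N K Y Z)).realize M N p -
    (nabla M N K Y (nabla M N K X Z)).realize M N p -
    (nabla M N K (decomp M N (lieBr (X.realize M N) (Y.realize M N))) Z).realize M N p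

/-- The adapted spatial derivative is the derivative along the adapted frame field. -/
lemma fderiv_apply_delX (N : E n → Fin n → Fin n → ℝ) (f : E n → ℝ) (i : Fin n) (p : E n) :
    fderiv ℝ f p (delX N i p) = dX N f i p := by
  have h : delX N i p = ((0, Pi.single i 1, 0) : E n)
      - ∑ k, N p i k • ((0, 0, Pi.single k 1) : E n) := by
    refine Prod.ext ?_ (Prod.ext ?_ ?_)
    · simp [delX, Prod.fst_sum]
    · simp [delX, Prod.fst_sum, Prod.snd_sum]
    · funext r
      simp [delX, Prod.snd_sum, Finset.sum_apply, Pi.single_apply]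
  rw [h, map_sub, map_sum]
  simp only [map_smul, smul_eq_mul, dX, pX, pY]

lemma realize_frX (M : E n → Fin n → ℝ) (N : E n → Fin n → Fin n → ℝ) (i : Fin n) :
    (frX i).realize M N = delX N i := by
  funext p
  simp [DVF.realize, frX, delX, Pi.single_apply]

/-- A horizontal spatial field is the combination of the frame `δ/δx^l` given by its components. -/
lemma realize_eq_sum_delX (M : E n → Fin n → ℝ) (N : E n → Fin n → Fin n → ℝ) (X : DVF n)
    (p : E n) (ha : X.a p = 0) (hc : X.c p = 0) :
    X.realize M N p = ∑ l, X.b p l • delX N l p := by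
  refine Prod.ext ?_ (Prod.ext ?_ ?_)
  · simp [DVF.realize, delX, Prod.fst_sum, ha]
  · funext r
    simp [DVF.realize, delX, Prod.fst_sum, Prod.snd_sum, Finset.sum_apply, Pi.single_apply]
  · funext r
    simp [DVF.realize, delX, Prod.snd_sum, Finset.sum_apply, ha, hc]

lemma nabla_a_eq_zero (M : E n → Fin n → ℝ) (N : E n → Fin n → Fin n → ℝ) (K : Conn n)
    (X W : DVF n) (ha : W.a = 0) : (nabla M N K X W).a = 0 := by
  funext p
  simp [nabla, Xder, ha]

lemma nabla_c_eq_zero (M : E n → Fin n → ℝ) (N : E n → Fin n → Fin n → ℝ) (K : Conn n)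
    (X W : DVF n) (hc : W.c = 0) : (nabla M N K X W).c = 0 := by
  funext p k
  simp [nabla, Xder, hc]

lemma nabla_frX_b (M : E n → Fin n → ℝ) (N : E n → Fin n → Fin n → ℝ) (K : Conn n)
    (j : Fin n) (W : DVF n) (p : E n) (l : Fin n) :
    (nabla M N K (frX j) W).b p l =
      dX N (fun q => W.b q l) j p + ∑ r, W.b p r * K.L p l r j := by
  simp only [nabla, Xder, realize_frX, fderiv_apply_delX]
  simp [frX, Pi.single_apply]

lemma nabla_b_frX (M : E n → Fin n → ℝ) (N : E n → Fin n → Fin n → ℝ) (K : Conn n)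
    (X : DVF n) (i : Fin n) (p : E n) (l : Fin n) :
    (nabla M N K X (frX i)).b p l =
      X.a p * K.G p l i + ∑ j, X.b p j * K.L p l i j + ∑ j, X.c p j * K.C p l i j := by
  simp [nabla, Xder, frX, Pi.single_apply]

lemma nabla_frX_b_frX (M : E n → Fin n → ℝ) (N : E n → Fin n → Fin n → ℝ) (K : Conn n)
    (i j : Fin n) (p : E n) (l : Fin n) :
    (nabla M N K (frX j) (frX i)).b p l = K.L p l i j := by
  rw [nabla_b_frX]
  simp [frX, Pi.single_apply]

lemma fderiv_delX_apply (N : E n → Fin n → Fin n → ℝ) (hN : Differentiable ℝ N) (j : Fin n)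
    (p v : E n) :
    fderiv ℝ (delX N j) p v = (0, 0, fun r => -fderiv ℝ (fun q => N q j r) p v) := by
  have hr (r : Fin n) : HasFDerivAt (fun q => -N q j r) (-fderiv ℝ (fun q => N q j r) p) p :=
    (DifferentiableAt.hasFDerivAt (by fun_prop)).neg
  have h : HasFDerivAt (delX N j) _ p :=
    (hasFDerivAt_const (0 : ℝ) p).prodMk
      ((hasFDerivAt_const (Pi.single j 1 : Fin n → ℝ) p).prodMk (hasFDerivAt_pi.2 hr))
  rw [h.fderiv]
  rfl

/-- The bracket of two spatial frame fields is vertical. -/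
lemma lieBr_delX_delX (N : E n → Fin n → Fin n → ℝ) (hN : Differentiable ℝ N) (j k : Fin n)
    (p : E n) :
    lieBr (delX N k) (delX N j) p =
      (0, 0, fun r => -(dX N (fun q => N q j r) k p - dX N (fun q => N q k r) j p)) := by
  simp only [lieBr, fderiv_delX_apply N hN, fderiv_apply_delX]
  refine Prod.ext (by simp) (Prod.ext (by simp) ?_)
  funext r
  simp only [Prod.snd_sub, Pi.sub_apply]
  ring

/-- `R(δ/δx^k, δ/δx^j) δ/δx^i = Σ_l R^l_{ijk}·δ/δx^l`, where
`R^l_{ijk} := δL^l_{ij}/δx^k − δL^l_{ik}/δx^j + Σ_r (L^r_{ij} L^l_{rk} − L^r_{ik} L^l_{rj})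
+ Σ_r C^l_{ir} R^r_{jk}` and `R^r_{jk} := δN^r_j/δx^k − δN^r_k/δx^j`. -/
theorem curv_delX_delX_delX (n : ℕ) (M : E n → Fin n → ℝ) (N : E n → Fin n → Fin n → ℝ)
    (hM : ContDiff ℝ (⊤ : ℕ∞) M) (hN : ContDiff ℝ (⊤ : ℕ∞) N) (K : Conn n) (hK : K.Smooth) (i j k : Fin n) :
    curv M N K (frX k) (frX j) (frX i) = fun p =>
      ∑ l, (dX N (fun q => K.L q l i j) k p - dX N (fun q => K.L q l i k) j p
        + (∑ r, (K.L p r i j * K.L p l r k - K.L p r i k * K.L p l r j))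
        + ∑ r, K.C p l i r *
            (dX N (fun q => N q j r) k p - dX N (fun q => N q k r) j p)) • delX N l p := by
  funext p
  have hbr := lieBr_delX_delX N (hN.differentiable (by simp)) j k p
  have ha (i : Fin n) : (frX i).a = 0 := rfl
  have hc (i : Fin n) : (frX i).c = 0 := rfl
  have hreal (X W : DVF n) (hWa : W.a = 0) (hWc : W.c = 0) :
      (nabla M N K X W).realize M N p = ∑ l, (nabla M N K X W).b p l • delX N l p :=
    realize_eq_sum_delX M N _ p (by rw [nabla_a_eq_zero M N K X W hWa, Pi.zero_apply])
      (by rw [nabla_c_eq_zero M N K X W hWc, Pi.zero_apply])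
  have hreal₂ (X Y : DVF n) := hreal X (nabla M N K Y (frX i))
    (nabla_a_eq_zero M N K Y _ (ha i)) (nabla_c_eq_zero M N K Y _ (hc i))
  simp only [curv]
  rw [hreal₂, hreal₂, hreal _ _ (ha i) (hc i), ← Finset.sum_sub_distrib,
    ← Finset.sum_sub_distrib]
  refine Finset.sum_congr rfl fun l _ => ?_
  rw [← sub_smul, ← sub_smul]
  congr 1
  rw [nabla_frX_b, nabla_frX_b, nabla_b_frX]
  simp only [nabla_frX_b_frX, decomp, realize_frX, hbr, Pi.zero_apply, zero_mul,
    Finset.sum_const_zero, add_zero, zero_add, Finset.sum_sub_distrib, neg_mul,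
    Finset.sum_neg_distrib]
  simp only [mul_comm (K.C p l i _)]
  ring
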